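/- arXiv:1203.0290 — 3 statements merged into one kernel-verified Lean document; each statement's English description precedes it below -/
import Mathlib

section
/- Let ω be a non-degenerate 3-form on F_q^m. For 0 ≤ i ≤ ⌊(m−1)/2⌋ let X_i(ω) = P{x ≠ 0 : Pf_{i+1}(ι_x ω) = 0} ⊆ P^{m−1} and n_i = |X_i(ω)| − |X_{i−1}(ω)|. Then the weight of ω as a codeword of C(3,m) satisfies wt(ω) = q^{2m−4} / ((q^2−1)(1+q+q^2)) · Σ_{i=1}^{⌊(m−1)/2⌋} n_i (1 − q^{−2i}). -/
open ExteriorAlgebra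
open scoped LinearAlgebra.Projectivization

set_option synthInstance.maxHeartbeats 1000000

/-- Interior multiplication `ι_v` of a form (an element of the exterior algebra of the
dual space) by a vector `v`, characterized by `⟨ι_v α, β⟩ = ⟨α, v ∧ β⟩`. -/
noncomputable def iMul (F : Type*) [Field F] {V : Type*} [AddCommGroup V] [Module F V] (v : V) :
    ExteriorAlgebra F (Module.Dual F V) →ₗ[F] ExteriorAlgebra F (Module.Dual F V) :=
  CliffordAlgebra.contractLeft (Module.Dual.eval F V v)

namespace WeightFormula

open Module

section Contraction

variable {F V : Type*} [Field F] [AddCommGroup V] [Module F V]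

/-- Interior multiplication, linear in the vector as well as in the form. -/
noncomputable def contraction (F V : Type*) [Field F] [AddCommGroup V] [Module F V] :
    V →ₗ[F] ExteriorAlgebra F (Dual F V) →ₗ[F] ExteriorAlgebra F (Dual F V) :=
  CliffordAlgebra.contractLeft ∘ₗ Dual.eval F V

theorem contraction_apply (v : V) : contraction F V v = iMul F v := rfl

theorem iMul_add_vec (u v : V) (w : ExteriorAlgebra F (Dual F V)) :
    iMul F (u + v) w = iMul F u w + iMul F v w := by
  simp [← contraction_apply]

theorem iMul_smul_vec (c : F) (v : V) (w : ExteriorAlgebra F (Dual F V)) :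
    iMul F (c • v) w = c • iMul F v w := by
  simp [← contraction_apply]

theorem iMul_zero_vec (w : ExteriorAlgebra F (Dual F V)) : iMul F (0 : V) w = 0 := by
  simp [← contraction_apply]

theorem iMul_ι_mul (v : V) (a : Dual F V) (w : ExteriorAlgebra F (Dual F V)) :
    iMul F v (ι F a * w) = a v • w - ι F a * iMul F v w :=
  CliffordAlgebra.contractLeft_ι_mul _ a w

theorem iMul_ι (v : V) (a : Dual F V) : iMul F v (ι F a) = algebraMap F _ (a v) :=
  CliffordAlgebra.contractLeft_ι _ (Dual.eval F V v) a

theorem iMul_algebraMap (v : V) (r : F) :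
    iMul F v (algebraMap F (ExteriorAlgebra F (Dual F V)) r) = 0 :=
  CliffordAlgebra.contractLeft_algebraMap _ (Dual.eval F V v) r

theorem iMul_self (v : V) (w : ExteriorAlgebra F (Dual F V)) : iMul F v (iMul F v w) = 0 :=
  CliffordAlgebra.contractLeft_contractLeft _ w

theorem iMul_comm (u v : V) (w : ExteriorAlgebra F (Dual F V)) :
    iMul F u (iMul F v w) = -iMul F v (iMul F u w) :=
  CliffordAlgebra.contractLeft_comm _ _ w

theorem iMul_mem_exteriorPower (v : V) (d : ℕ) {w : ExteriorAlgebra F (Dual F V)}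
    (hw : w ∈ ⋀[F]^(d + 1) (Dual F V)) : iMul F v w ∈ ⋀[F]^d (Dual F V) := by
  induction d generalizing w with
  | zero =>
    obtain ⟨a, rfl⟩ : w ∈ LinearMap.range (ι F (M := Dual F V)) := by simpa using hw
    rw [iMul_ι]
    simp only [pow_zero, Submodule.one_eq_range]
    exact ⟨a v, rfl⟩
  | succ d ih =>
    rw [exteriorPower, pow_succ'] at hw
    induction hw using Submodule.mul_induction_on' with
    | mem_mul_mem x hx y hy =>
      obtain ⟨a, rfl⟩ := hx
      rw [iMul_ι_mul]
      refine Submodule.sub_mem _ (Submodule.smul_mem _ _ hy) ?_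
      rw [exteriorPower, pow_succ']
      exact Submodule.mul_mem_mul ⟨a, rfl⟩ (ih hy)
    | add x _ y _ hx hy => rw [map_add]; exact Submodule.add_mem _ hx hy

/-- Subtracting `e` times the contraction with `v` is the algebra map induced by
`a ↦ a - a v • e`. -/
theorem map_sub_smul_eq (e : Dual F V) (v : V) (w : ExteriorAlgebra F (Dual F V)) :
    ExteriorAlgebra.map (LinearMap.id - (Dual.eval F V v).smulRight e) w
      = w - ι F e * iMul F v w := by
  induction w using CliffordAlgebra.left_induction with
  | algebraMap r =>
    change ExteriorAlgebra.map _ (algebraMap F (ExteriorAlgebra F (Dual F V)) r) =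
      algebraMap F (ExteriorAlgebra F (Dual F V)) r -
        ι F e * iMul F v (algebraMap F (ExteriorAlgebra F (Dual F V)) r)
    rw [iMul_algebraMap, AlgHom.commutes]; simp
  | add x y hx hy => rw [map_add, map_add, hx, hy, mul_add]; abel
  | ι_mul x a hx =>
    change ExteriorAlgebra.map _ (ι F a * x) = ι F a * x - ι F e * iMul F v (ι F a * x)
    rw [map_mul, hx, map_apply_ι, iMul_ι_mul]
    have h1 : ι F e * ι F e = 0 := ι_sq_zero e
    have h2 : ι F e * ι F a = -(ι F a * ι F e) := eq_neg_of_add_eq_zero_left (ι_add_mul_swap e a)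
    simp only [LinearMap.sub_apply, LinearMap.id_apply, LinearMap.smulRight_apply,
      Dual.eval_apply, map_sub, map_smul, mul_sub, sub_mul, smul_mul_assoc, mul_smul_comm]
    rw [← mul_assoc (ι F e), ← mul_assoc (ι F e), h1, h2]
    simp [mul_assoc]
    abel

theorem exists_eq_algebraMap_of_mem_exteriorPower_zero {w : ExteriorAlgebra F (Dual F V)}
    (hw : w ∈ ⋀[F]^0 (Dual F V)) : ∃ r : F, w = algebraMap F _ r := by
  simp only [pow_zero, Submodule.one_eq_range] at hw
  obtain ⟨r, rfl⟩ := hw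
  exact ⟨r, rfl⟩

/-- The linear map `v ↦ ι_v l` attached to a form `l`. -/
noncomputable def polarMap (l : ExteriorAlgebra F (Dual F V)) :
    V →ₗ[F] ExteriorAlgebra F (Dual F V) :=
  (contraction F V).flip l

theorem polarMap_apply (l : ExteriorAlgebra F (Dual F V)) (v : V) :
    polarMap l v = iMul F v l := rfl

theorem polarMap_mem_range_ι {l : ExteriorAlgebra F (Dual F V)} (hl : l ∈ ⋀[F]^2 (Dual F V))
    (v : V) : ∃ a : Dual F V, iMul F v l = ι F a := by
  have := iMul_mem_exteriorPower v 1 hl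
  rw [exteriorPower, pow_one] at this
  obtain ⟨a, ha⟩ := this
  exact ⟨a, ha.symm⟩

/-- The rank of a form `l`: the rank of the linear map `v ↦ ι_v l`. -/
noncomputable def formRank (l : ExteriorAlgebra F (Dual F V)) : ℕ := finrank F (polarMap l).range

theorem finrank_le_finrank_inf_ker_add_one {W : Type*} [AddCommGroup W] [Module F W]
    [FiniteDimensional F W] (A : Submodule F W) (f : W →ₗ[F] F) :
    finrank F A ≤ finrank F ↥(A ⊓ f.ker) + 1 := by
  have h1 := (f.domRestrict A).finrank_range_add_finrank_ker
  have h2 : finrank F (f.domRestrict A).range ≤ 1 := by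
    simpa using (f.domRestrict A).range.finrank_le
  have h3 : (f.domRestrict A).ker.map A.subtype = A ⊓ f.ker := by
    ext x; simp [and_comm]
  rw [← h3, Submodule.finrank_map_subtype_eq]
  omega

variable [FiniteDimensional F V]

/-- A form all of whose contractions vanish is a scalar. -/
theorem eq_algebraMap_of_iMul_eq_zero {w : ExteriorAlgebra F (Dual F V)}
    (hw : ∀ v : V, iMul F v w = 0) : ∃ r : F, w = algebraMap F _ r := by
  classical
  let b := finBasis F V
  have key (s : Finset (Fin (finrank F V))) :
      ExteriorAlgebra.map
        (LinearMap.id - ∑ i ∈ s, (Dual.eval F V (b i)).smulRight (b.coord i)) w = w := by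
    induction s using Finset.induction_on with
    | empty =>
      have h : LinearMap.id - ∑ i ∈ (∅ : Finset (Fin (finrank F V))),
          (Dual.eval F V (b i)).smulRight (b.coord i) = LinearMap.id := by ext; simp
      rw [h, ExteriorAlgebra.map_id, AlgHom.id_apply]
    | insert i s hi ih =>
      have hcomp : LinearMap.id - ∑ j ∈ insert i s, (Dual.eval F V (b j)).smulRight (b.coord j)
          = (LinearMap.id - (Dual.eval F V (b i)).smulRight (b.coord i)) ∘ₗ
            (LinearMap.id - ∑ j ∈ s, (Dual.eval F V (b j)).smulRight (b.coord j)) := by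
        ext a u
        have h0 : ∑ j ∈ s, a (b j) * Finsupp.single i (1 : F) j = 0 := by
          refine Finset.sum_eq_zero fun j hj => ?_
          have : i ≠ j := fun h => hi (h ▸ hj)
          simp [this]
        simp [Finset.sum_insert hi, LinearMap.sum_apply, h0]
        ring
      rw [hcomp, ← map_comp_map, AlgHom.comp_apply, ih, map_sub_smul_eq, hw]
      simp
  have h0 : LinearMap.id - ∑ i, (Dual.eval F V (b i)).smulRight (b.coord i) = 0 := by
    ext a u
    simp [LinearMap.sum_apply]
  have hmap : ExteriorAlgebra.map (0 : Dual F V →ₗ[F] Dual F V)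
      = (Algebra.ofId F _).comp algebraMapInv := by
    ext a
    simp [algebraMapInv]
  refine ⟨algebraMapInv w, ?_⟩
  conv_lhs => rw [← key Finset.univ, h0, hmap]
  rfl

theorem exists_iMul_ne_zero {d : ℕ} {w : ExteriorAlgebra F (Dual F V)}
    (hw : w ∈ ⋀[F]^(d + 1) (Dual F V)) (h0 : w ≠ 0) : ∃ v : V, iMul F v w ≠ 0 := by
  by_contra! h
  obtain ⟨r, rfl⟩ := eq_algebraMap_of_iMul_eq_zero h
  have h1 : algebraMap F (ExteriorAlgebra F (Dual F V)) r ∈ ⋀[F]^0 (Dual F V) := by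
    simp only [pow_zero, Submodule.one_eq_range]
    exact ⟨r, rfl⟩
  have := (DirectSum.Decomposition.isInternal
    (fun i : ℕ => ⋀[F]^i (Dual F V))).submodule_iSupIndep.pairwiseDisjoint (Nat.succ_ne_zero d)
  exact h0 (Submodule.disjoint_def.mp this _ hw h1)

/-- A nonzero `d`-form on `V` killed by all contractions with vectors of `K` satisfies
`d + dim K ≤ dim V`. -/
theorem degree_add_finrank_le {d : ℕ} {w : ExteriorAlgebra F (Dual F V)}
    (hw : w ∈ ⋀[F]^d (Dual F V)) (h0 : w ≠ 0) (K : Submodule F V)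
    (hK : ∀ v ∈ K, iMul F v w = 0) : d + finrank F K ≤ finrank F V := by
  induction d generalizing w K with
  | zero => simpa using K.finrank_le
  | succ d ih =>
    obtain ⟨u, hu⟩ := exists_iMul_ne_zero hw h0
    have hlt : finrank F K < finrank F ↥(K ⊔ F ∙ u) := by
      refine Submodule.finrank_lt_finrank_of_lt (lt_of_le_of_ne le_sup_left fun h => hu (hK u ?_))
      rw [h]
      exact Submodule.mem_sup_right (Submodule.mem_span_singleton_self u)
    have := ih (iMul_mem_exteriorPower u d hw) hu (K ⊔ F ∙ u) fun v hv => by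
      obtain ⟨k, hk, y, hy, rfl⟩ := Submodule.mem_sup.mp hv
      obtain ⟨c, rfl⟩ := Submodule.mem_span_singleton.mp hy
      rw [iMul_add_vec, iMul_smul_vec, iMul_self, iMul_comm, hK k hk]
      simp
    omega

/-- A nonzero `d`-form is killed by exterior multiplication with at most `d` independent
covectors. -/
theorem finrank_le_degree {d : ℕ} {w : ExteriorAlgebra F (Dual F V)}
    (hw : w ∈ ⋀[F]^d (Dual F V)) (h0 : w ≠ 0) (A : Submodule F (Dual F V))
    (hA : ∀ a ∈ A, ι F a * w = 0) : finrank F A ≤ d := by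
  induction d generalizing w A with
  | zero =>
    obtain ⟨r, rfl⟩ := exists_eq_algebraMap_of_mem_exteriorPower_zero hw
    have hr : r ≠ 0 := by rintro rfl; simp at h0
    have : A = ⊥ := by
      refine (Submodule.eq_bot_iff _).mpr fun a ha => ?_
      have := hA a ha
      rw [← Algebra.commutes, ← Algebra.smul_def, smul_eq_zero] at this
      exact (ι_eq_zero_iff a).mp (this.resolve_left hr)
    simp [this]
  | succ d ih =>
    by_cases hbot : A = ⊥
    · rw [hbot, finrank_bot]
      exact Nat.zero_le _
    obtain ⟨a, ha, hane⟩ := A.ne_bot_iff.mp hbot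
    obtain ⟨v, hv⟩ : ∃ v, a v ≠ 0 := by
      by_contra! h
      exact hane (LinearMap.ext h)
    have hv0 : iMul F v w ≠ 0 := fun h => by
      have := iMul_ι_mul v a w
      rw [hA a ha, h] at this
      rw [mul_zero, sub_zero, map_zero] at this
      exact smul_ne_zero hv h0 this.symm
    have := ih (iMul_mem_exteriorPower v d hw) hv0 (A ⊓ (Dual.eval F V v).ker) fun b hb => by
      have hbv : b v = 0 := hb.2
      have := iMul_ι_mul v b w
      rw [hA b hb.1, hbv] at this
      simpa using this.symm
    have := finrank_le_finrank_inf_ker_add_one A (Dual.eval F V v)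
    omega

section Pfaffian

variable {Pf : ℕ → ExteriorAlgebra F (Dual F V)} {l : ExteriorAlgebra F (Dual F V)}

theorem two_mul_le_formRank (hPfmem : ∀ k, Pf k ∈ ⋀[F]^(2 * k) (Dual F V))
    (hPf : ∀ k v, iMul F v (Pf (k + 1)) = iMul F v l * Pf k) {k : ℕ} (hk : Pf k ≠ 0) :
    2 * k ≤ formRank l := by
  cases k with
  | zero => simp
  | succ k =>
    have h1 := degree_add_finrank_le (hPfmem (k + 1)) hk (polarMap l).ker fun v hv => by
      rw [hPf, ← polarMap_apply, LinearMap.mem_ker.mp hv, zero_mul]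
    have h2 := (polarMap l).finrank_range_add_finrank_ker
    rw [← formRank] at h2
    omega

theorem pfaffian_succ_ne_zero (hl : l ∈ ⋀[F]^2 (Dual F V))
    (hPfmem : ∀ k, Pf k ∈ ⋀[F]^(2 * k) (Dual F V))
    (hPf : ∀ k v, iMul F v (Pf (k + 1)) = iMul F v l * Pf k) {k : ℕ} (hk : Pf k ≠ 0)
    (hlt : 2 * k < formRank l) : Pf (k + 1) ≠ 0 := by
  intro h0
  let A : Submodule F (Dual F V) :=
    ((LinearMap.mulRight F (Pf k)) ∘ₗ (ι F : Dual F V →ₗ[F] ExteriorAlgebra F (Dual F V))).ker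
  have h1 : finrank F A ≤ 2 * k := finrank_le_degree (hPfmem k) hk A fun a ha => ha
  have h2 : (polarMap l).range ≤ A.map (ι F) := by
    rintro _ ⟨v, rfl⟩
    obtain ⟨a, ha⟩ := polarMap_mem_range_ι hl v
    refine ⟨a, ?_, ha.symm⟩
    have := hPf k v
    rw [h0, map_zero, ha] at this
    exact this.symm
  have h3 := (Submodule.finrank_mono h2).trans (Submodule.finrank_map_le _ A)
  rw [← formRank] at h3
  omega

theorem pfaffian_ne_zero_iff (hl : l ∈ ⋀[F]^2 (Dual F V)) (hPf0 : Pf 0 = 1)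
    (hPfmem : ∀ k, Pf k ∈ ⋀[F]^(2 * k) (Dual F V))
    (hPf : ∀ k v, iMul F v (Pf (k + 1)) = iMul F v l * Pf k) (k : ℕ) :
    Pf k ≠ 0 ↔ 2 * k ≤ formRank l := by
  refine ⟨two_mul_le_formRank hPfmem hPf, fun h => ?_⟩
  induction k with
  | zero => rw [hPf0]; exact one_ne_zero
  | succ k ih => exact pfaffian_succ_ne_zero hl hPfmem hPf (ih (by omega)) (by omega)

theorem even_formRank (hl : l ∈ ⋀[F]^2 (Dual F V)) (hPf0 : Pf 0 = 1)
    (hPfmem : ∀ k, Pf k ∈ ⋀[F]^(2 * k) (Dual F V))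
    (hPf : ∀ k v, iMul F v (Pf (k + 1)) = iMul F v l * Pf k) : Even (formRank l) := by
  by_contra h
  obtain ⟨k, hk⟩ := Nat.not_even_iff_odd.mp h
  have h1 := (pfaffian_ne_zero_iff hl hPf0 hPfmem hPf k).mpr (by omega)
  have := two_mul_le_formRank hPfmem hPf
    (pfaffian_succ_ne_zero hl hPfmem hPf h1 (by omega))
  omega

end Pfaffian

end Contraction

section Counting

variable {F V : Type*} [Field F] [AddCommGroup V] [Module F V]

theorem AlternatingMap.map_linearIndependent_ne_zero {k : ℕ} {W N : Type*} [AddCommGroup W]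
    [Module F W] [FiniteDimensional F W] [AddCommGroup N] [Module F N] (Ω : W [⋀^Fin k]→ₗ[F] N)
    (hW : finrank F W = k) (hΩ : ∃ t, Ω t ≠ 0) {s : Fin k → W} (hs : LinearIndependent F s) :
    Ω s ≠ 0 := by
  intro h0
  obtain ⟨t, ht⟩ := hΩ
  let b : Basis (Fin k) F W :=
    basisOfLinearIndependentOfCardEqFinrank' s hs (by simp [hW])
  have hb : ⇑b = s := by simp [b]
  refine ht ?_
  suffices Ω = 0 by rw [this]; rfl
  refine b.ext_alternating fun v hv => ?_
  let σ : Equiv.Perm (Fin k) := Equiv.ofBijective v (Finite.injective_iff_bijective.mp hv)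
  have : (fun i => b (v i)) = s ∘ σ := by rw [hb]; rfl
  rw [this, AlternatingMap.map_perm, h0]
  simp

theorem nonZeroEquivProjectivizationProdUnits_fst (v : {v : V // v ≠ 0}) :
    (Projectivization.nonZeroEquivProjectivizationProdUnits F V v).1 =
      Projectivization.mk F v.1 v.2 := rfl

theorem formRank_smul (c : Fˣ) (l : ExteriorAlgebra F (Dual F V)) :
    formRank (c • l) = formRank l := by
  have : polarMap (c • l) = (c : F) • polarMap l := by
    simp [polarMap, Units.smul_def]
  rw [formRank, this, LinearMap.range_smul _ _ c.ne_zero, formRank]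

theorem formRank_iMul_lt_finrank [FiniteDimensional F V] (ω : ExteriorAlgebra F (Dual F V))
    {x : V} (hx : x ≠ 0) : formRank (iMul F x ω) < finrank F V := by
  have h1 := (polarMap (iMul F x ω)).finrank_range_add_finrank_ker
  have h2 : 0 < finrank F (polarMap (iMul F x ω)).ker :=
    Module.finrank_pos_iff_exists_ne_zero.mpr
      ⟨⟨x, by rw [LinearMap.mem_ker, polarMap_apply, iMul_self]⟩,
        fun h => hx (congrArg Subtype.val h)⟩
  rw [formRank]
  omega

theorem formRank_pos [FiniteDimensional F V] {d : ℕ} {l : ExteriorAlgebra F (Dual F V)}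
    (hl : l ∈ ⋀[F]^(d + 1) (Dual F V)) (h0 : l ≠ 0) : 0 < formRank l := by
  obtain ⟨v, hv⟩ := exists_iMul_ne_zero hl h0
  refine Module.finrank_pos_iff_exists_ne_zero.mpr ⟨⟨polarMap l v, v, rfl⟩, fun h => hv ?_⟩
  exact congrArg Subtype.val h

variable [Fintype F] [Finite V]

/-- Each `k`-dimensional subspace on which an alternating `k`-form does not vanish has exactly
as many `k`-tuples with nonzero value as it has ordered bases. -/
theorem card_map_ne_zero {k : ℕ} {N : Type*} [AddCommGroup N] [Module F N]
    (Ω : V [⋀^Fin k]→ₗ[F] N) :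
    Nat.card {t : Fin k → V // Ω t ≠ 0} =
      Nat.card {Λ : Submodule F V // finrank F Λ = k ∧ ∃ t : Fin k → V, (∀ i, t i ∈ Λ) ∧ Ω t ≠ 0} *
        ∏ i : Fin k, (Fintype.card F ^ k - Fintype.card F ^ (i : ℕ)) := by
  classical
  let G := {Λ : Submodule F V // finrank F Λ = k ∧ ∃ t : Fin k → V, (∀ i, t i ∈ Λ) ∧ Ω t ≠ 0}
  have hne (Λ : G) (s : Fin k → Λ.1) (hs : LinearIndependent F s) :
      Ω (fun i => (s i : V)) ≠ 0 := by
    obtain ⟨t, ht, htΩ⟩ := Λ.2.2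
    exact AlternatingMap.map_linearIndependent_ne_zero (Ω.compLinearMap Λ.1.subtype) Λ.2.1
      ⟨fun i => ⟨t i, ht i⟩, htΩ⟩ hs
  let f : (Σ Λ : G, {s : Fin k → Λ.1 // LinearIndependent F s}) → {t : Fin k → V // Ω t ≠ 0} :=
    fun p => ⟨fun i => (p.2.1 i : V), hne p.1 p.2.1 p.2.2⟩
  have hspan (p : Σ Λ : G, {s : Fin k → Λ.1 // LinearIndependent F s}) :
      Submodule.span F (Set.range (f p).1) = p.1.1 := by
    obtain ⟨Λ, s, hs⟩ := p
    have h := hs.span_eq_top_of_card_eq_finrank' (by simp [Λ.2.1])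
    have h1 : Set.range (fun i => (s i : V)) = Λ.1.subtype '' Set.range s := by
      rw [← Set.range_comp]; rfl
    change Submodule.span F (Set.range fun i => (s i : V)) = Λ.1
    rw [h1, Submodule.span_image, h, Submodule.map_subtype_top]
  have hf : Function.Bijective f := by
    constructor
    · intro p p' h
      have hΛ : p.1 = p'.1 := Subtype.ext (by rw [← hspan p, ← hspan p', h])
      obtain ⟨Λ, s, hs⟩ := p
      obtain ⟨Λ', s', hs'⟩ := p'
      obtain rfl : Λ = Λ' := hΛ
      have : s = s' := by
        funext i
        exact Subtype.ext (congrFun (congrArg Subtype.val h) i)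
      subst this
      rfl
    · rintro ⟨t, ht⟩
      have hli : LinearIndependent F t := by
        by_contra h
        exact ht (Ω.map_linearDependent t h)
      refine ⟨⟨⟨Submodule.span F (Set.range t), ?_, t, fun i => Submodule.subset_span ⟨i, rfl⟩, ht⟩,
        fun i => ⟨t i, Submodule.subset_span ⟨i, rfl⟩⟩, ?_⟩, rfl⟩
      · rw [finrank_span_eq_card hli, Fintype.card_fin]
      · exact linearIndependent_span hli
  have : Fintype G := Fintype.ofFinite G
  rw [← Nat.card_congr (Equiv.ofBijective f hf), Nat.card_sigma]
  have hfib (Λ : G) : Nat.card {s : Fin k → Λ.1 // LinearIndependent F s} =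
      ∏ i : Fin k, (Fintype.card F ^ k - Fintype.card F ^ (i : ℕ)) := by
    rw [card_linearIndependent Λ.2.1.ge, Λ.2.1]
  rw [Finset.sum_congr rfl fun Λ _ => hfib Λ, Finset.sum_const, Finset.card_univ,
    ← Nat.card_eq_fintype_card, smul_eq_mul]

theorem card_apply_ne_zero {W : Type*} [AddCommGroup W] [Module F W] (f : V →ₗ[F] W) :
    (Nat.card {v // f v ≠ 0} : ℚ) = (Fintype.card F : ℚ) ^ finrank F V *
      (1 - (Fintype.card F : ℚ) ^ (-(finrank F f.range : ℤ))) := by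
  classical
  have hq : (Fintype.card F : ℚ) ≠ 0 := by exact_mod_cast Fintype.card_ne_zero
  have : Fintype V := Fintype.ofFinite V
  have h1 : Nat.card {v // f v ≠ 0} + Nat.card f.ker = Nat.card V := by
    have := Nat.card_congr (Equiv.sumCompl fun v => f v = 0)
    rw [Nat.card_sum] at this
    rw [← this, add_comm]
    rfl
  rw [Module.natCard_eq_pow_finrank (K := F) (V := f.ker),
    Module.natCard_eq_pow_finrank (K := F) (V := V),
    Nat.card_eq_fintype_card (α := F)] at h1
  have h2 : (Nat.card {v // f v ≠ 0} : ℚ) + (Fintype.card F : ℚ) ^ finrank F f.ker =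
      (Fintype.card F : ℚ) ^ finrank F V := by exact_mod_cast h1
  rw [eq_sub_of_add_eq h2, ← f.finrank_range_add_finrank_ker, zpow_neg, zpow_natCast, pow_add]
  field_simp

theorem card_iMul_iMul_ne_zero {l : ExteriorAlgebra F (Dual F V)} (hl : l ∈ ⋀[F]^2 (Dual F V)) :
    (Nat.card {p : V × V // iMul F p.2 (iMul F p.1 l) ≠ 0} : ℚ) =
      (Fintype.card F : ℚ) ^ finrank F V * (1 - (Fintype.card F : ℚ) ^ (-(formRank l : ℤ))) *
        ((Fintype.card F : ℚ) ^ finrank F V * (1 - (Fintype.card F : ℚ)⁻¹)) := by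
  classical
  let e : {p : V × V // iMul F p.2 (iMul F p.1 l) ≠ 0} ≃
      Σ u : {u : V // polarMap l u ≠ 0}, {v : V // iMul F v (iMul F u.1 l) ≠ 0} :=
    { toFun := fun p => ⟨⟨p.1.1, fun h => p.2 (by rw [← polarMap_apply l, h, map_zero])⟩,
        ⟨p.1.2, p.2⟩⟩
      invFun := fun p => ⟨(p.1.1, p.2.1), p.2.2⟩ }
  have : Fintype {u : V // polarMap l u ≠ 0} := Fintype.ofFinite _
  have hfib (u : {u : V // polarMap l u ≠ 0}) :
      (Nat.card {v : V // iMul F v (iMul F u.1 l) ≠ 0} : ℚ) =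
        (Fintype.card F : ℚ) ^ finrank F V * (1 - (Fintype.card F : ℚ)⁻¹) := by
    obtain ⟨u, hu⟩ := u
    obtain ⟨a, ha⟩ := polarMap_mem_range_ι hl u
    have ha0 : a ≠ 0 := by
      rintro rfl
      exact hu (by rw [polarMap_apply, ha, map_zero])
    have hcard : Nat.card {v : V // iMul F v (iMul F u l) ≠ 0} = Nat.card {v : V // a v ≠ 0} := by
      refine Nat.card_congr (Equiv.subtypeEquivRight fun v => ?_)
      rw [ha, iMul_ι, Ne, algebraMap_eq_zero_iff]
    have hr : finrank F (LinearMap.range a) = 1 := by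
      rw [LinearMap.range_eq_top.mpr (LinearMap.surjective_of_ne_zero ha0)]
      simp
    change (Nat.card {v : V // iMul F v (iMul F u l) ≠ 0} : ℚ) = _
    rw [hcard, card_apply_ne_zero, hr]
    simp
  rw [Nat.card_congr e, Nat.card_sigma, Nat.cast_sum, Finset.sum_congr rfl fun u _ => hfib u,
    Finset.sum_const, Finset.card_univ, ← Nat.card_eq_fintype_card, nsmul_eq_mul,
    card_apply_ne_zero]
  rfl

omit [Finite V] in
theorem sum_eq_card_sub_one_mul_sum_rep [Fintype V] [Fintype (ℙ F V)] (g : V → ℚ) (h0 : g 0 = 0)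
    (hg : ∀ (c : Fˣ) v, g (c • v) = g v) :
    ∑ v, g v = ((Fintype.card F : ℚ) - 1) * ∑ p : ℙ F V, g p.rep := by
  classical
  have h1 : ∑ v, g v = ∑ v : {v : V // v ≠ 0}, g v := by
    rw [← Finset.sum_subtype ({v | v ≠ 0} : Finset V) (by simp)]
    refine (Finset.sum_subset (Finset.subset_univ _) fun v _ hv => ?_).symm
    obtain rfl : v = 0 := by simpa using hv
    exact h0
  have h2 (v : {v : V // v ≠ 0}) : g v = g (Projectivization.mk F v.1 v.2).rep := by
    obtain ⟨c, hc⟩ := Projectivization.exists_smul_eq_mk_rep F v.1 v.2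
    rw [← hc, hg]
  have h3 : ∑ v : {v : V // v ≠ 0}, g v = ∑ x : ℙ F V × Fˣ, g x.1.rep :=
    Fintype.sum_equiv (Projectivization.nonZeroEquivProjectivizationProdUnits F V) _ _ fun v => by
      rw [h2, nonZeroEquivProjectivizationProdUnits_fst]
  rw [h1, h3, Fintype.sum_prod_type]
  simp only [Finset.sum_const, Finset.card_univ, nsmul_eq_mul, Fintype.card_units]
  rw [← Finset.mul_sum, Nat.cast_sub Fintype.card_pos, Nat.cast_one]

/-- The trilinear form `(v₁, v₂, v₃) ↦ ι_{v₃} ι_{v₂} ι_{v₁} ω`. -/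
noncomputable def iteratedContraction (ω : ExteriorAlgebra F (Dual F V)) :
    V [⋀^Fin 3]→ₗ[F] ExteriorAlgebra F (Dual F V) where
  toFun v := iMul F (v 2) (iMul F (v 1) (iMul F (v 0) ω))
  map_update_add' := by
    intro inst v i x y
    obtain rfl : inst = instDecidableEqFin 3 := Subsingleton.elim _ _
    fin_cases i <;> simp [iMul_add_vec]
  map_update_smul' := by
    intro inst v i c x
    obtain rfl : inst = instDecidableEqFin 3 := Subsingleton.elim _ _
    fin_cases i <;> simp [iMul_smul_vec]
  map_eq_zero_of_eq' v i j h hij := by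
    fin_cases i <;> fin_cases j <;> simp at h hij ⊢ <;>
      first
      | rw [h, iMul_self, map_zero]
      | rw [h, iMul_self]
      | rw [h, iMul_comm (v 1), iMul_self, neg_zero]
      | rw [h, iMul_comm (v 1), h, iMul_self, neg_zero]
      | rw [iMul_comm, ← h, iMul_self, map_zero, neg_zero]

theorem card_iteratedContraction_ne_zero [Fintype (ℙ F V)] {ω : ExteriorAlgebra F (Dual F V)}
    (hω : ω ∈ ⋀[F]^3 (Dual F V)) :
    (Nat.card {t : Fin 3 → V // iteratedContraction ω t ≠ 0} : ℚ) =
      (Fintype.card F : ℚ) ^ finrank F V * (1 - (Fintype.card F : ℚ)⁻¹) *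
        (Fintype.card F : ℚ) ^ finrank F V * ((Fintype.card F : ℚ) - 1) *
          ∑ p : ℙ F V, (1 - (Fintype.card F : ℚ) ^ (-(formRank (iMul F p.rep ω) : ℤ))) := by
  classical
  have : Fintype V := Fintype.ofFinite V
  let e : {t : Fin 3 → V // iteratedContraction ω t ≠ 0} ≃
      Σ x : V, {p : V × V // iMul F p.2 (iMul F p.1 (iMul F x ω)) ≠ 0} :=
    { toFun := fun t => ⟨t.1 0, (t.1 1, t.1 2), t.2⟩
      invFun := fun p => ⟨![p.1, p.2.1.1, p.2.1.2], p.2.2⟩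
      left_inv := fun t => by
        ext i
        fin_cases i <;> rfl }
  rw [Nat.card_congr e, Nat.card_sigma, Nat.cast_sum,
    Finset.sum_congr rfl fun x _ => card_iMul_iMul_ne_zero (iMul_mem_exteriorPower x 2 hω),
    ← Finset.sum_mul, ← Finset.mul_sum,
    sum_eq_card_sub_one_mul_sum_rep (F := F)
      (fun x => 1 - (Fintype.card F : ℚ) ^ (-(formRank (iMul F x ω) : ℤ)))]
  · ring
  · have h0 : polarMap (iMul F (0 : V) ω) = 0 := by rw [iMul_zero_vec]; exact map_zero _
    rw [formRank, h0, LinearMap.range_zero, finrank_bot]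
    simp
  · intro c v
    change 1 - (Fintype.card F : ℚ) ^ (-(formRank (iMul F ((c : F) • v) ω) : ℤ)) = _
    rw [iMul_smul_vec]
    change 1 - (Fintype.card F : ℚ) ^ (-(formRank (c • iMul F v ω) : ℤ)) = _
    rw [formRank_smul]

end Counting

end WeightFormula

open WeightFormula

/-- For a non-degenerate 3-form `ω` on `F_q^m`, with weight varieties
`X_i(ω) = P{x ≠ 0 : Pf_{i+1}(ι_x ω) = 0} ⊆ P^{m−1}` and `n_i = |X_i| − |X_{i−1}|`, the weight
of `ω` as a codeword of `C(3,m)` (the number of 3-dimensional subspaces on which `ω` does not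
vanish identically) equals
`q^{2m−4}/((q²−1)(1+q+q²)) · Σ_{i=1}^{⌊(m−1)/2⌋} n_i (1 − q^{−2i})`. -/
theorem nondegenerate_three_form_weight_formula
    (F : Type*) [Field F] [Fintype F] (q m : ℕ) (hq : Fintype.card F = q)
    (Pf : ExteriorAlgebra F (Module.Dual F (Fin m → F)) → ℕ →
      ExteriorAlgebra F (Module.Dual F (Fin m → F)))
    (hPf0 : ∀ l, Pf l 0 = 1)
    (hPfmem : ∀ l ∈ ⋀[F]^2 (Module.Dual F (Fin m → F)), ∀ k : ℕ, 1 ≤ k →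
      Pf l k ∈ ⋀[F]^(2 * k) (Module.Dual F (Fin m → F)))
    (hPf : ∀ l ∈ ⋀[F]^2 (Module.Dual F (Fin m → F)), ∀ (k : ℕ) (v : Fin m → F),
      iMul F v (Pf l (k + 1)) = iMul F v l * Pf l k)
    (ω : ExteriorAlgebra F (Module.Dual F (Fin m → F)))
    (hω3 : ω ∈ ⋀[F]^3 (Module.Dual F (Fin m → F)))
    (hnd : ∀ x : Fin m → F, iMul F x ω = 0 → x = 0)
    (X : ℕ → Set (ℙ F (Fin m → F)))
    (hX : ∀ i, X i = {p | ∃ v, ∃ hv : v ≠ 0, p = Projectivization.mk F v hv ∧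
      Pf (iMul F v ω) (i + 1) = 0})
    (n : ℕ → ℚ)
    (hn : ∀ i : ℕ, 1 ≤ i → n i = (Nat.card ↥(X i) : ℚ) - (Nat.card ↥(X (i - 1)) : ℚ)) :
    (Nat.card {Λ : Submodule F (Fin m → F) // Module.finrank F Λ = 3 ∧
        ∃ v₁ ∈ Λ, ∃ v₂ ∈ Λ, ∃ v₃ ∈ Λ, iMul F v₃ (iMul F v₂ (iMul F v₁ ω)) ≠ 0} : ℚ)
      = (q : ℚ) ^ (2 * m - 4) / (((q : ℚ) ^ 2 - 1) * (1 + (q : ℚ) + (q : ℚ) ^ 2)) *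
        ∑ i ∈ Finset.Icc 1 ((m - 1) / 2), n i * (1 - (q : ℚ) ^ (-(2 * (i : ℤ)))) := by
  classical
  have : Fintype (ℙ F (Fin m → F)) := Fintype.ofFinite _
  have hm : Module.finrank F (Fin m → F) = m := by simp
  let ρ : ℙ F (Fin m → F) → ℕ := fun p => formRank (iMul F p.rep ω)
  have hl (x : Fin m → F) := iMul_mem_exteriorPower x 2 hω3
  have hmem (x : Fin m → F) (k : ℕ) :
      Pf (iMul F x ω) k ∈ ⋀[F]^(2 * k) (Module.Dual F (Fin m → F)) := by
    rcases k.eq_zero_or_pos with rfl | hk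
    · rw [hPf0]
      simp only [mul_zero, pow_zero, Submodule.one_eq_range]
      exact ⟨1, (algebraMap F _).map_one⟩
    · exact hPfmem _ (hl x) k hk
  have heven (p : ℙ F (Fin m → F)) : Even (ρ p) :=
    even_formRank (hl p.rep) (hPf0 _) (hmem p.rep) (hPf _ (hl p.rep))
  have hXmem (i : ℕ) (p : ℙ F (Fin m → F)) : p ∈ X i ↔ ρ p / 2 ≤ i := by
    have hrank {x : Fin m → F} (hx : x ≠ 0) :
        formRank (iMul F x ω) = ρ (Projectivization.mk F x hx) := by
      obtain ⟨c, hc⟩ := Projectivization.exists_smul_eq_mk_rep F x hx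
      change _ = formRank (iMul F (Projectivization.mk F x hx).rep ω)
      rw [← hc, Units.smul_def, iMul_smul_vec, ← Units.smul_def, formRank_smul]
    have hiff (x : Fin m → F) : Pf (iMul F x ω) (i + 1) = 0 ↔
        formRank (iMul F x ω) < 2 * (i + 1) := by
      have := pfaffian_ne_zero_iff (hl x) (hPf0 _) (hmem x) (hPf _ (hl x)) (i + 1)
      rw [← not_le, ← this, not_not]
    rw [hX]
    constructor
    · rintro ⟨v, hv, rfl, h⟩
      have := (hiff v).mp h
      rw [hrank hv] at this
      omega
    · intro h
      refine ⟨p.rep, p.rep_nonzero, p.mk_rep.symm, (hiff _).mpr ?_⟩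
      change ρ p < _
      omega
  have hn' (i : ℕ) (hi : 1 ≤ i) : n i = (Finset.univ.filter fun p => ρ p / 2 = i).card := by
    have hcard (j : ℕ) : Nat.card (X j) = (Finset.univ.filter fun p => ρ p / 2 ≤ j).card := by
      rw [← Fintype.card_subtype, ← Nat.card_eq_fintype_card]
      exact Nat.card_congr (Equiv.subtypeEquivRight (hXmem j))
    have hsplit : (Finset.univ.filter fun p => ρ p / 2 ≤ i).card =
        (Finset.univ.filter fun p => ρ p / 2 ≤ i - 1).card +
          (Finset.univ.filter fun p => ρ p / 2 = i).card := by
      rw [← Finset.card_union_of_disjoint, ← Finset.filter_or]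
      · congr 1
        ext p
        simp only [Finset.mem_filter, Finset.mem_univ, true_and]
        omega
      · refine Finset.disjoint_filter.mpr fun p _ h => ?_
        omega
    rw [hn i hi, hcard, hcard, hsplit]
    push_cast
    ring
  have hsum : ∑ p : ℙ F (Fin m → F), (1 - (q : ℚ) ^ (-(ρ p : ℤ))) =
      ∑ i ∈ Finset.Icc 1 ((m - 1) / 2), n i * (1 - (q : ℚ) ^ (-(2 * (i : ℤ)))) := by
    rw [← Finset.sum_fiberwise_of_maps_to (t := Finset.Icc 1 ((m - 1) / 2))
      (g := fun p => ρ p / 2)]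
    · refine Finset.sum_congr rfl fun i hi => ?_
      rw [hn' i (Finset.mem_Icc.mp hi).1, ← nsmul_eq_mul, ← Finset.sum_const]
      refine Finset.sum_congr rfl fun p hp => ?_
      have h1 : ρ p / 2 = i := (Finset.mem_filter.mp hp).2
      obtain ⟨r, hr⟩ := heven p
      have h2 : (ρ p : ℤ) = 2 * (i : ℤ) := by omega
      rw [h2]
    · intro p _
      have h1 : ρ p < m := hm ▸ formRank_iMul_lt_finrank ω p.rep_nonzero
      have h2 : 0 < ρ p := formRank_pos (hl p.rep) fun h => p.rep_nonzero (hnd _ h)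
      obtain ⟨r, hr⟩ := heven p
      rw [Finset.mem_Icc]
      omega
  have hΛ : Nat.card {Λ : Submodule F (Fin m → F) // Module.finrank F Λ = 3 ∧
        ∃ v₁ ∈ Λ, ∃ v₂ ∈ Λ, ∃ v₃ ∈ Λ, iMul F v₃ (iMul F v₂ (iMul F v₁ ω)) ≠ 0} =
      Nat.card {Λ : Submodule F (Fin m → F) // Module.finrank F Λ = 3 ∧
        ∃ t : Fin 3 → Fin m → F, (∀ i, t i ∈ Λ) ∧ iteratedContraction ω t ≠ 0} := by
    refine Nat.card_congr (Equiv.subtypeEquivRight fun Λ => and_congr_right fun _ => ?_)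
    constructor
    · rintro ⟨v₁, h₁, v₂, h₂, v₃, h₃, h⟩
      exact ⟨![v₁, v₂, v₃], by simp [Fin.forall_fin_succ, h₁, h₂, h₃], h⟩
    · rintro ⟨t, ht, h⟩
      exact ⟨t 0, ht 0, t 1, ht 1, t 2, ht 2, h⟩
  have hq1 : (1 : ℚ) < q := by exact_mod_cast hq ▸ Fintype.one_lt_card (α := F)
  have hcount := card_iteratedContraction_ne_zero hω3
  rw [card_map_ne_zero, ← hΛ, hq, hm, hsum] at hcount
  have hq1' : 1 ≤ q := by exact_mod_cast hq1.le
  rw [Fin.prod_univ_three, Nat.cast_mul, Nat.cast_mul, Nat.cast_mul,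
    Nat.cast_sub (Nat.pow_le_pow_right hq1' (by decide)),
    Nat.cast_sub (Nat.pow_le_pow_right hq1' (by decide)),
    Nat.cast_sub (Nat.pow_le_pow_right hq1' (by decide))] at hcount
  generalize (Nat.card {Λ : Submodule F (Fin m → F) // Module.finrank F Λ = 3 ∧
    ∃ v₁ ∈ Λ, ∃ v₂ ∈ Λ, ∃ v₃ ∈ Λ, iMul F v₃ (iMul F v₂ (iMul F v₁ ω)) ≠ 0} : ℚ) = N at hcount ⊢
  have ha : (q : ℚ) ≠ 0 := by positivity
  have hb : (q : ℚ) - 1 ≠ 0 := (sub_pos.mpr hq1).ne'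
  have hc : (q : ℚ) + 1 ≠ 0 := by positivity
  have hd : 1 + (q : ℚ) + (q : ℚ) ^ 2 ≠ 0 := by positivity
  have he : (q : ℚ) ^ 2 - 1 ≠ 0 := by
    rw [show (q : ℚ) ^ 2 - 1 = (q - 1) * (q + 1) by ring]
    exact mul_ne_zero hb hc
  have hfac : N * ((q : ℚ) ^ 3 * (q - 1) ^ 2 * ((q ^ 2 - 1) * (1 + q + q ^ 2))) =
      (q : ℚ) ^ (2 * m) * (1 - (q : ℚ)⁻¹) * (q - 1) *
        ∑ i ∈ Finset.Icc 1 ((m - 1) / 2), n i * (1 - (q : ℚ) ^ (-(2 * (i : ℤ)))) := by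
    rw [two_mul, pow_add]
    calc _ = _ := by push_cast [Fin.val_zero, Fin.val_one, Fin.val_two]; ring
      _ = _ := hcount
      _ = _ := by ring
  by_cases hm3 : m < 3
  · have hempty : Finset.Icc 1 ((m - 1) / 2) = ∅ := Finset.Icc_eq_empty (by omega)
    rw [hempty, Finset.sum_empty, mul_zero] at hfac ⊢
    refine (mul_eq_zero.mp hfac).resolve_right ?_
    positivity
  · obtain ⟨k, rfl⟩ := Nat.exists_eq_add_of_le (not_lt.mp hm3)
    rw [show 2 * (3 + k) - 4 = 2 * k + 2 by omega]
    rw [show 2 * (3 + k) = 2 * k + 2 + 4 by ring, pow_add (q : ℚ) (2 * k + 2) 4] at hfac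
    generalize (∑ i ∈ Finset.Icc 1 ((3 + k - 1) / 2),
      n i * (1 - (q : ℚ) ^ (-(2 * (i : ℤ))))) = S at hfac ⊢
    generalize (q : ℚ) ^ (2 * k + 2) = Q at hfac ⊢
    rw [div_mul_eq_mul_div, eq_div_iff (mul_ne_zero he hd)]
    refine mul_left_cancel₀ (mul_ne_zero (pow_ne_zero 3 ha) (pow_ne_zero 2 hb)) ?_
    calc _ = _ := by ring
      _ = _ := hfac
      _ = _ := by field_simp
end

section
/- Let ω be a non-degenerate 3-form on V = F^7 and fix a basis vector η of ⋀^7 V*. Let H_η : ⋀^6 V* → V be the isomorphism determined by α ∧ β = ⟨β, H_η(α)⟩ η for all α ∈ ⋀^6 V*, β ∈ V*. Then there is a quadratic form Q_ω on V such that H_η(Pf_3(ι_x ω)) = Q_ω(x) · x for all x ∈ V; in particular the set X_2(ω) = P{x ≠ 0 : Pf_3(ι_x ω) = 0} ⊆ P^6 is the quadric hypersurface {Q_ω = 0}. -/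
open ExteriorAlgebra
open scoped LinearAlgebra.Projectivization

set_option synthInstance.maxHeartbeats 1000000

section ExteriorAlgebraLemmas

variable {R M : Type*} [CommRing R] [AddCommGroup M] [Module R M]

theorem ExteriorAlgebra.ι_mul_ι_anticomm (a b : M) : ι R a * ι R b = -(ι R b * ι R a) :=
  eq_neg_of_add_eq_zero_left (ι_add_mul_swap a b)

theorem ExteriorAlgebra.mul_ι_eq_ι_mul_involute (α : ExteriorAlgebra R M) (m : M) :
    α * ι R m = ι R m * CliffordAlgebra.involute α := by
  induction α using CliffordAlgebra.left_induction with
  | algebraMap r => rw [AlgHom.commutes, Algebra.commutes]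
  | add x y hx hy => rw [add_mul, map_add, mul_add, hx, hy]
  | ι_mul x a hx =>
    rw [mul_assoc, hx, map_mul, CliffordAlgebra.involute_ι, ← mul_assoc, ← mul_assoc]
    change ι R a * ι R m * _ = ι R m * -ι R a * _
    rw [ι_mul_ι_anticomm, mul_neg]

theorem ExteriorAlgebra.involute_eq_self {k : ℕ} {α : ExteriorAlgebra R M}
    (hα : α ∈ ⋀[R]^(2 * k) M) : CliffordAlgebra.involute α = α := by
  refine CliffordAlgebra.involute_eq_of_mem_even ?_
  refine Submodule.mem_iSup_of_mem ⟨2 * k, ?_⟩ hα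
  push_cast
  rw [show (2 : ZMod 2) = 0 from rfl, zero_mul]

/-- Forms of even degree are central. -/
theorem ExteriorAlgebra.mul_comm_of_mem_even {k : ℕ} {α : ExteriorAlgebra R M}
    (hα : α ∈ ⋀[R]^(2 * k) M) (β : ExteriorAlgebra R M) : α * β = β * α := by
  induction β using CliffordAlgebra.left_induction with
  | algebraMap r => rw [Algebra.commutes]
  | add x y hx hy => rw [add_mul, mul_add, hx, hy]
  | ι_mul x a hx =>
    have h := mul_ι_eq_ι_mul_involute α a
    rw [involute_eq_self hα] at h
    rw [mul_assoc, ← hx, ← mul_assoc, ← mul_assoc]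
    exact congrArg (· * x) h

theorem ExteriorAlgebra.contractLeft_mul (d : Module.Dual R M) (α β : ExteriorAlgebra R M) :
    CliffordAlgebra.contractLeft d (α * β) =
      CliffordAlgebra.contractLeft d α * β +
        CliffordAlgebra.involute α * CliffordAlgebra.contractLeft d β := by
  induction α using CliffordAlgebra.left_induction with
  | algebraMap r =>
    rw [CliffordAlgebra.contractLeft_algebraMap_mul, CliffordAlgebra.contractLeft_algebraMap,
      AlgHom.commutes, zero_mul, zero_add]
  | add x y hx hy =>
    rw [add_mul, map_add, hx, hy, map_add, map_add, add_mul, add_mul, add_add_add_comm]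
  | ι_mul x a hx =>
    rw [mul_assoc, CliffordAlgebra.contractLeft_ι_mul, hx, CliffordAlgebra.contractLeft_ι_mul,
      map_mul, CliffordAlgebra.involute_ι, sub_mul, smul_mul_assoc, mul_add, neg_mul, neg_mul,
      mul_assoc, mul_assoc, sub_add_eq_sub_sub, ← sub_eq_add_neg]

theorem ExteriorAlgebra.mul_mem_exteriorPower {i j n : ℕ} (hn : i + j = n)
    {α β : ExteriorAlgebra R M} (hα : α ∈ ⋀[R]^i M) (hβ : β ∈ ⋀[R]^j M) : α * β ∈ ⋀[R]^n M := by
  subst hn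
  exact SetLike.mul_mem_graded hα hβ

theorem ExteriorAlgebra.contractLeft_mem (d : Module.Dual R M) {n : ℕ} {α : ExteriorAlgebra R M}
    (hα : α ∈ ⋀[R]^(n + 1) M) : CliffordAlgebra.contractLeft d α ∈ ⋀[R]^n M := by
  induction n generalizing α with
  | zero =>
    rw [zero_add, exteriorPower, pow_one] at hα
    obtain ⟨m, rfl⟩ := hα
    rw [exteriorPower, pow_zero]
    exact Submodule.mem_one.2 ⟨d m, (CliffordAlgebra.contractLeft_ι _ d m).symm⟩
  | succ n ih =>
    rw [exteriorPower, pow_succ'] at hα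
    refine Submodule.mul_induction_on hα ?_ fun x y hx hy => by
      rw [map_add]; exact Submodule.add_mem _ hx hy
    rintro _ ⟨m, rfl⟩ β hβ
    have h := CliffordAlgebra.contractLeft_ι_mul (Q := (0 : QuadraticForm R M)) d m β
    refine h ▸ Submodule.sub_mem _ (Submodule.smul_mem _ _ hβ) ?_
    rw [exteriorPower, pow_succ']
    exact Submodule.mul_mem_mul ⟨m, rfl⟩ (ih hβ)

theorem ExteriorAlgebra.map_id_sub_smulRight (d : Module.Dual R M) (f : M)
    (α : ExteriorAlgebra R M) :
    map (LinearMap.id - d.smulRight f) α = α - ι R f * CliffordAlgebra.contractLeft d α := by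
  induction α using CliffordAlgebra.left_induction with
  | algebraMap r =>
    rw [AlgHom.commutes, CliffordAlgebra.contractLeft_algebraMap, mul_zero, sub_zero]
  | add x y hx hy => rw [map_add, hx, hy, map_add, mul_add, add_sub_add_comm]
  | ι_mul x a hx =>
    rw [map_mul, hx, CliffordAlgebra.contractLeft_ι_mul]
    change map _ (ι R a) * _ = ι R a * _ - _ * (_ - ι R a * _)
    have h1 : ι R f * ι R f = 0 := ι_sq_zero f
    rw [map_apply_ι, LinearMap.sub_apply, LinearMap.id_apply, LinearMap.smulRight_apply, map_sub,
      map_smul, sub_mul, mul_sub, mul_sub, mul_sub, ← mul_assoc, ← mul_assoc (ι R f),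
      ι_mul_ι_anticomm a f, smul_mul_assoc, smul_mul_assoc, ← mul_assoc (ι R f) (ι R f), h1,
      mul_smul_comm, zero_mul, smul_zero, sub_zero, neg_mul, sub_neg_eq_add, sub_sub_eq_add_sub]

theorem ExteriorAlgebra.map_zero_eq_zero {n : ℕ} {α : ExteriorAlgebra R M}
    (hα : α ∈ ⋀[R]^(n + 1) M) : map (0 : M →ₗ[R] M) α = 0 := by
  rw [exteriorPower, pow_succ'] at hα
  refine Submodule.mul_induction_on hα ?_ fun x y hx hy => by rw [map_add, hx, hy, add_zero]
  rintro _ ⟨m, rfl⟩ β -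
  rw [map_mul, map_apply_ι, LinearMap.zero_apply, map_zero, zero_mul]

/-- A form of positive degree all of whose contractions vanish is zero. -/
theorem ExteriorAlgebra.eq_zero_of_forall_contractLeft_eq_zero {κ : Type*} [Fintype κ]
    (b : Module.Basis κ R M) {n : ℕ} {α : ExteriorAlgebra R M} (hα : α ∈ ⋀[R]^(n + 1) M)
    (h : ∀ i, CliffordAlgebra.contractLeft (b.coord i) α = 0) : α = 0 := by
  classical
  have key (s : Finset κ) :
      map (LinearMap.id - ∑ i ∈ s, (b.coord i).smulRight (b i)) α = α := by
    induction s using Finset.induction_on with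
    | empty => simp
    | insert j s hj ih =>
      have hcomp : LinearMap.id - ∑ i ∈ insert j s, (b.coord i).smulRight (b i) =
          (LinearMap.id - ∑ i ∈ s, (b.coord i).smulRight (b i)) ∘ₗ
            (LinearMap.id - (b.coord j).smulRight (b j)) := by
        refine LinearMap.ext fun m => ?_
        have h0 : ∑ i ∈ s, (b.repr (b j)) i • b i = 0 := Finset.sum_eq_zero fun i hi => by
          rw [Module.Basis.repr_self, Finsupp.single_eq_of_ne (by rintro rfl; exact hj hi),
            zero_smul]
        simp only [Finset.sum_insert hj, LinearMap.sub_apply, LinearMap.id_apply,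
          LinearMap.add_apply, LinearMap.smulRight_apply, LinearMap.comp_apply,
          LinearMap.sum_apply, Module.Basis.coord_apply, map_sub, map_smul, h0]
        rw [sub_zero, sub_add_eq_sub_sub_swap]
      rw [hcomp, ← map_comp_map, AlgHom.comp_apply, map_id_sub_smulRight, h, mul_zero, sub_zero,
        ih]
  have hzero : LinearMap.id - ∑ i, (b.coord i).smulRight (b i) = 0 := by
    refine LinearMap.ext fun m => ?_
    simp [b.sum_repr]
  rw [← key Finset.univ, hzero, map_zero_eq_zero hα]

/-- A top-degree form killed by contraction with a nonzero vector is zero. -/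
theorem ExteriorAlgebra.eq_zero_of_contractLeft_eq_zero {K V : Type*} [Field K] [AddCommGroup V]
    [Module K V] [Module.Finite K V] {d : Module.Dual K V} (hd : d ≠ 0)
    {α : ExteriorAlgebra K V} (hα : α ∈ ⋀[K]^(Module.finrank K V) V)
    (h : CliffordAlgebra.contractLeft d α = 0) : α = 0 := by
  obtain ⟨m, hm⟩ : ∃ m, d m = 1 := by
    obtain ⟨m, hm⟩ := DFunLike.ne_iff.1 hd
    exact ⟨(d m)⁻¹ • m, by rw [map_smul, smul_eq_mul, inv_mul_cancel₀ hm]⟩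
  have hmem : ι K m * α ∈ ⋀[K]^(Module.finrank K V + 1) V := by
    rw [exteriorPower, pow_succ']
    exact Submodule.mul_mem_mul ⟨m, rfl⟩ hα
  have hzero : ι K m * α = 0 := by
    rw [← ιMulti_span_fixedDegree] at hmem
    refine (Submodule.mem_bot K).1 (Submodule.span_le.2 ?_ hmem)
    rintro _ ⟨v, rfl⟩
    refine AlternatingMap.map_linearDependent _ v fun hv => ?_
    have := hv.fintype_card_le_finrank
    simp at this
  have hc := congrArg (CliffordAlgebra.contractLeft d) hzero
  have h' := CliffordAlgebra.contractLeft_ι_mul (Q := (0 : QuadraticForm K V)) d m α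
  rw [h, hm, one_smul, mul_zero, sub_zero] at h'
  rw [← h']
  exact hc.trans (map_zero _)

end ExteriorAlgebraLemmas

section Pfaffian

variable {F V : Type*} [Field F] [AddCommGroup V] [Module F V]

theorem iMul_mem (v : V) {n : ℕ} {α : ExteriorAlgebra F (Module.Dual F V)}
    (hα : α ∈ ⋀[F]^(n + 1) (Module.Dual F V)) : iMul F v α ∈ ⋀[F]^n (Module.Dual F V) :=
  contractLeft_mem _ hα

theorem iMul_iMul_self (v : V) (α : ExteriorAlgebra F (Module.Dual F V)) :
    iMul F v (iMul F v α) = 0 :=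
  CliffordAlgebra.contractLeft_contractLeft _ _

theorem iMul_comm (v w : V) (α : ExteriorAlgebra F (Module.Dual F V)) :
    iMul F v (iMul F w α) = -iMul F w (iMul F v α) :=
  CliffordAlgebra.contractLeft_comm _ _ _

theorem iMul_add_left (v w : V) (α : ExteriorAlgebra F (Module.Dual F V)) :
    iMul F (v + w) α = iMul F v α + iMul F w α := by
  simp only [iMul, map_add, LinearMap.add_apply]

theorem iMul_smul_left (c : F) (v : V) (α : ExteriorAlgebra F (Module.Dual F V)) :
    iMul F (c • v) α = c • iMul F v α := by
  simp only [iMul, map_smul, LinearMap.smul_apply]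

theorem iMul_ι_mul (v : V) (β : Module.Dual F V) (α : ExteriorAlgebra F (Module.Dual F V)) :
    iMul F v (ι F β * α) = β v • α - ι F β * iMul F v α :=
  CliffordAlgebra.contractLeft_ι_mul _ _ _

theorem iMul_mul_of_mem_even (v : V) {k : ℕ} {α : ExteriorAlgebra F (Module.Dual F V)}
    (hα : α ∈ ⋀[F]^(2 * k) (Module.Dual F V)) (β : ExteriorAlgebra F (Module.Dual F V)) :
    iMul F v (α * β) = iMul F v α * β + α * iMul F v β := by
  have h := contractLeft_mul (Module.Dual.eval F V v) α β
  rwa [involute_eq_self hα] at h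

theorem eq_of_forall_iMul_eq [Module.Finite F V] {n : ℕ}
    {α β : ExteriorAlgebra F (Module.Dual F V)}
    (hα : α ∈ ⋀[F]^(n + 1) (Module.Dual F V)) (hβ : β ∈ ⋀[F]^(n + 1) (Module.Dual F V))
    (h : ∀ v : V, iMul F v α = iMul F v β) : α = β := by
  refine sub_eq_zero.1 (eq_zero_of_forall_contractLeft_eq_zero
    (Module.finBasis F (Module.Dual F V)) (Submodule.sub_mem _ hα hβ) fun i => ?_)
  obtain ⟨v, hv⟩ := (Module.evalEquiv F V).surjective
    ((Module.finBasis F (Module.Dual F V)).coord i)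
  rw [← hv]
  exact (map_sub (iMul F v) α β).trans (sub_eq_zero.2 (h v))

theorem eq_zero_of_iMul_eq_zero [Module.Finite F V] {x : V} (hx : x ≠ 0)
    {α : ExteriorAlgebra F (Module.Dual F V)}
    (hα : α ∈ ⋀[F]^(Module.finrank F V) (Module.Dual F V)) (h : iMul F x α = 0) : α = 0 := by
  refine eq_zero_of_contractLeft_eq_zero (d := Module.Dual.eval F V x) ?_ ?_ h
  · rwa [Ne, Module.eval_apply_eq_zero_iff]
  · rwa [Subspace.dual_finrank_eq]

/-- The divided powers of 2-forms, characterized by their contractions. -/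
structure IsPfaffian (Pf : ExteriorAlgebra F (Module.Dual F V) → ℕ →
    ExteriorAlgebra F (Module.Dual F V)) : Prop where
  zero : ∀ l, Pf l 0 = 1
  mem_of_one_le : ∀ l ∈ ⋀[F]^2 (Module.Dual F V), ∀ k : ℕ, 1 ≤ k →
    Pf l k ∈ ⋀[F]^(2 * k) (Module.Dual F V)
  iMul_succ : ∀ l ∈ ⋀[F]^2 (Module.Dual F V), ∀ (k : ℕ) (v : V),
    iMul F v (Pf l (k + 1)) = iMul F v l * Pf l k

namespace IsPfaffian

variable {Pf : ExteriorAlgebra F (Module.Dual F V) → ℕ → ExteriorAlgebra F (Module.Dual F V)}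
  {l m : ExteriorAlgebra F (Module.Dual F V)}

theorem mem (h : IsPfaffian Pf) (hl : l ∈ ⋀[F]^2 (Module.Dual F V)) (k : ℕ) :
    Pf l (k + 1) ∈ ⋀[F]^(2 * (k + 1)) (Module.Dual F V) :=
  h.mem_of_one_le l hl _ (Nat.le_add_left 1 k)

variable [Module.Finite F V]

theorem one (h : IsPfaffian Pf) (hl : l ∈ ⋀[F]^2 (Module.Dual F V)) : Pf l 1 = l :=
  eq_of_forall_iMul_eq (n := 1) (h.mem hl 0) hl fun v => by
    rw [h.iMul_succ l hl, h.zero, mul_one]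

theorem smul (h : IsPfaffian Pf) (c : F) (hl : l ∈ ⋀[F]^2 (Module.Dual F V)) (k : ℕ) :
    Pf (c • l) k = c ^ k • Pf l k := by
  induction k with
  | zero => rw [h.zero, h.zero, pow_zero, one_smul]
  | succ k ih =>
    have hcl := Submodule.smul_mem _ c hl
    refine eq_of_forall_iMul_eq (n := 2 * k + 1) (h.mem hcl k)
      (Submodule.smul_mem _ _ (h.mem hl k)) fun v => ?_
    rw [h.iMul_succ _ hcl, map_smul, map_smul, h.iMul_succ l hl, ih, smul_mul_smul_comm, pow_succ']

theorem mul_self (h : IsPfaffian Pf) (hl : l ∈ ⋀[F]^2 (Module.Dual F V)) :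
    l * l = (2 : F) • Pf l 2 := by
  refine eq_of_forall_iMul_eq (n := 3) (mul_mem_exteriorPower (i := 2) (j := 2) rfl hl hl)
    (Submodule.smul_mem _ _ (h.mem hl 1)) fun v => ?_
  rw [iMul_mul_of_mem_even (k := 1) v hl, mul_comm_of_mem_even (k := 1) hl, map_smul,
    h.iMul_succ l hl, h.one hl, two_smul]

theorem two_mul_self (h : IsPfaffian Pf) (hl : l ∈ ⋀[F]^2 (Module.Dual F V)) :
    Pf l 2 * l = (3 : F) • Pf l 3 := by
  refine eq_of_forall_iMul_eq (n := 5) (mul_mem_exteriorPower (i := 4) (j := 2) rfl (h.mem hl 1) hl)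
    (Submodule.smul_mem _ _ (h.mem hl 2)) fun v => ?_
  rw [iMul_mul_of_mem_even v (h.mem hl 1), mul_comm_of_mem_even (h.mem hl 1), map_smul,
    h.iMul_succ l hl, h.iMul_succ l hl, h.one hl, mul_assoc, h.mul_self hl, mul_smul_comm,
    ← two_add_one_eq_three, add_smul, one_smul]

theorem two_add (h : IsPfaffian Pf) (hl : l ∈ ⋀[F]^2 (Module.Dual F V))
    (hm : m ∈ ⋀[F]^2 (Module.Dual F V)) : Pf (l + m) 2 = Pf l 2 + l * m + Pf m 2 := by
  have hlm := Submodule.add_mem _ hl hm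
  refine eq_of_forall_iMul_eq (n := 3) (h.mem hlm 1)
    (Submodule.add_mem _ (Submodule.add_mem _ (h.mem hl 1)
      (mul_mem_exteriorPower (i := 2) (j := 2) rfl hl hm))
      (h.mem hm 1)) fun v => ?_
  rw [h.iMul_succ _ hlm, map_add, map_add, map_add, h.iMul_succ l hl, h.iMul_succ m hm,
    iMul_mul_of_mem_even (k := 1) v hl, mul_comm_of_mem_even (k := 1) hl (iMul F v m), h.one hl,
    h.one hm, h.one hlm, add_mul, mul_add, mul_add]
  abel

theorem three_add (h : IsPfaffian Pf) (hl : l ∈ ⋀[F]^2 (Module.Dual F V))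
    (hm : m ∈ ⋀[F]^2 (Module.Dual F V)) :
    Pf (l + m) 3 = Pf l 3 + Pf l 2 * m + Pf m 2 * l + Pf m 3 := by
  have hlm := Submodule.add_mem _ hl hm
  refine eq_of_forall_iMul_eq (n := 5) (h.mem hlm 2)
    (Submodule.add_mem _ (Submodule.add_mem _ (Submodule.add_mem _ (h.mem hl 2)
      (mul_mem_exteriorPower (i := 4) (j := 2) rfl (h.mem hl 1) hm))
      (mul_mem_exteriorPower (i := 4) (j := 2) rfl (h.mem hm 1) hl))
      (h.mem hm 2)) fun v => ?_
  rw [h.iMul_succ _ hlm, map_add, map_add, map_add, map_add, h.iMul_succ l hl, h.iMul_succ m hm,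
    iMul_mul_of_mem_even v (h.mem hl 1), iMul_mul_of_mem_even v (h.mem hm 1),
    h.iMul_succ l hl, h.iMul_succ m hm, mul_comm_of_mem_even (h.mem hl 1) (iMul F v m),
    mul_comm_of_mem_even (h.mem hm 1) (iMul F v l), h.one hl, h.one hm, h.two_add hl hm,
    mul_assoc, mul_assoc, mul_comm_of_mem_even (k := 1) hm l, add_mul, mul_add, mul_add, mul_add,
    mul_add]
  abel

end IsPfaffian

end Pfaffian

/-- If `h x = q x • x` for a cubic map `h`, and `t x y` is the part of `h (x + y)` of bidegree
`(2, 1)`, then `t` determines the polar form of `q`. -/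
theorem polar_smul_eq {F V : Type*} [Field F] [AddCommGroup V] [Module F V] {h : V → V}
    {t : V → V → V} {q : V → F} {b : V → V → F} (hq : ∀ x, h x = q x • x)
    (hadd : ∀ x y, h (x + y) = h x + t x y + t y x + h y)
    (ht : ∀ x y, t x y = q x • y + b x y • x) (hq_smul : ∀ (c : F) x, q (c • x) = c ^ 2 * q x)
    (ht_smul : ∀ (c : F) x, t x (c • x) = (3 * c) • h x) (x y : V) :
    QuadraticMap.polar q x y • x = t x y - q x • y := by
  by_cases hy : ∃ c : F, c • x = y
  · obtain ⟨c, rfl⟩ := hy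
    have hsum : x + c • x = (1 + c) • x := by rw [add_smul, one_smul]
    rw [QuadraticMap.polar, hsum, hq_smul, hq_smul, ht_smul, hq]
    module
  · have key := hadd x y
    rw [hq, hq, hq, ht x y, ht y x] at key
    have hlin : (q (x + y) - q x - q y - b x y) • x = (q x + q y + b y x - q (x + y)) • y := by
      linear_combination (norm := module) key
    have hcoeff : q x + q y + b y x - q (x + y) = 0 := by
      by_contra hne
      exact hy ⟨(q x + q y + b y x - q (x + y))⁻¹ * (q (x + y) - q x - q y - b x y), by
        rw [mul_smul, hlin, inv_smul_smul₀ hne]⟩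
    rw [hcoeff, zero_smul] at hlin
    rw [ht, QuadraticMap.polar]
    linear_combination (norm := module) hlin
/-- Let `ω` be a non-degenerate 3-form on `V = F^7`, `η` a nonzero element
of `⋀^7 V*`, and `H_η : ⋀^6 V* → V` the isomorphism determined by
`α ∧ β = ⟨β, H_η(α)⟩ η`. Then there is a quadratic form `Q_ω` on `V` with
`H_η(Pf_3(ι_x ω)) = Q_ω(x) · x` for all `x`, and the cone over
`X_2(ω) = P{x ≠ 0 : Pf_3(ι_x ω) = 0}` is exactly the zero locus of `Q_ω`. -/
theorem X2_is_quadric (F : Type*) [Field F]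
    (Pf : ExteriorAlgebra F (Module.Dual F (Fin 7 → F)) → ℕ →
      ExteriorAlgebra F (Module.Dual F (Fin 7 → F)))
    (hPf0 : ∀ l, Pf l 0 = 1)
    (hPfmem : ∀ l ∈ ⋀[F]^2 (Module.Dual F (Fin 7 → F)), ∀ k : ℕ, 1 ≤ k →
      Pf l k ∈ ⋀[F]^(2 * k) (Module.Dual F (Fin 7 → F)))
    (hPf : ∀ l ∈ ⋀[F]^2 (Module.Dual F (Fin 7 → F)), ∀ (k : ℕ) (v : Fin 7 → F),
      iMul F v (Pf l (k + 1)) = iMul F v l * Pf l k)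
    (ω : ExteriorAlgebra F (Module.Dual F (Fin 7 → F)))
    (hω3 : ω ∈ ⋀[F]^3 (Module.Dual F (Fin 7 → F)))
    (hnd : ∀ x : Fin 7 → F, iMul F x ω = 0 → x = 0)
    (η : ExteriorAlgebra F (Module.Dual F (Fin 7 → F)))
    (hη7 : η ∈ ⋀[F]^7 (Module.Dual F (Fin 7 → F))) (hη : η ≠ 0)
    (Hη : ExteriorAlgebra F (Module.Dual F (Fin 7 → F)) →ₗ[F] (Fin 7 → F))
    (hHη : ∀ α ∈ ⋀[F]^6 (Module.Dual F (Fin 7 → F)), ∀ β : Module.Dual F (Fin 7 → F),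
      α * ExteriorAlgebra.ι F β = β (Hη α) • η) :
    ∃ Q : QuadraticForm F (Fin 7 → F),
      (∀ x : Fin 7 → F, Hη (Pf (iMul F x ω) 3) = Q x • x) ∧
      {x : Fin 7 → F | x ≠ 0 ∧ Pf (iMul F x ω) 3 = 0} =
        {x : Fin 7 → F | x ≠ 0 ∧ Q x = 0} := by
  have h : IsPfaffian Pf := ⟨hPf0, hPfmem, hPf⟩
  have hl (x : Fin 7 → F) := iMul_mem x hω3
  have hrank : Module.finrank F (Fin 7 → F) = 7 := Module.finrank_fin_fun F
  have hιη {x : Fin 7 → F} (hx : x ≠ 0) : iMul F x η ≠ 0 := fun h0 =>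
    hη (eq_zero_of_iMul_eq_zero hx (hrank.symm ▸ hη7) h0)
  have hpair {α : ExteriorAlgebra F (Module.Dual F (Fin 7 → F))}
      (hα : α ∈ ⋀[F]^6 (Module.Dual F (Fin 7 → F))) (β : Module.Dual F (Fin 7 → F))
      (x : Fin 7 → F) :
      β x • α - ι F β * iMul F x α = β (Hη α) • iMul F x η := by
    rw [← iMul_ι_mul, ← map_smul, ← hHη α hα β, mul_comm_of_mem_even (k := 3) hα]
  have hzero : Pf (iMul F 0 ω) 3 = 0 := by
    rw [← zero_smul F (0 : Fin 7 → F), iMul_smul_left, h.smul 0 (hl 0), zero_pow three_ne_zero,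
      zero_smul]
  have hkill (x : Fin 7 → F) : iMul F x (Pf (iMul F x ω) 3) = 0 := by
    rw [h.iMul_succ _ (hl x), iMul_iMul_self, zero_mul]
  have hmixed (x y : Fin 7 → F) : iMul F x (Pf (iMul F x ω) 2 * iMul F y ω) =
      -iMul F y (Pf (iMul F x ω) 3) := by
    rw [iMul_mul_of_mem_even x (h.mem (hl x) 1), h.iMul_succ _ (hl x), h.iMul_succ _ (hl x),
      iMul_iMul_self, zero_mul, zero_mul, zero_add, iMul_comm x y, mul_neg,
      mul_comm_of_mem_even (h.mem (hl x) 1)]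
  have hmem (x y : Fin 7 → F) : Pf (iMul F x ω) 2 * iMul F y ω ∈
      ⋀[F]^6 (Module.Dual F (Fin 7 → F)) := mul_mem_exteriorPower rfl (h.mem (hl x) 1) (hl y)
  have hdual {x : Fin 7 → F} (hx : x ≠ 0) : ∃ β : Module.Dual F (Fin 7 → F), β x = 1 :=
    Module.Projective.exists_dual_eq_one F hx
  have hspan {x : Fin 7 → F} (hx : x ≠ 0) {z : Fin 7 → F}
      (hz : ∀ β : Module.Dual F (Fin 7 → F), β x = 0 → β z = 0) : ∃ c : F, z = c • x := by
    obtain ⟨β, hβ⟩ := hdual hx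
    refine ⟨β z, sub_eq_zero.1 ((Module.forall_dual_apply_eq_zero_iff F _).1 fun γ => ?_)⟩
    have := hz (γ - γ x • β) (by simp [hβ])
    simp only [LinearMap.sub_apply, LinearMap.smul_apply, smul_eq_mul] at this
    simp only [map_sub, map_smul, smul_eq_mul]
    linear_combination this
  have hq (x : Fin 7 → F) : ∃ q : F, (x = 0 → q = 0) ∧ Pf (iMul F x ω) 3 = q • iMul F x η ∧
      Hη (Pf (iMul F x ω) 3) = q • x := by
    rcases eq_or_ne x 0 with rfl | hx
    · exact ⟨0, fun _ => rfl, by rw [hzero, zero_smul], by rw [hzero, map_zero, zero_smul]⟩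
    have hpair' (β : Module.Dual F (Fin 7 → F)) : β x • Pf (iMul F x ω) 3 =
        β (Hη (Pf (iMul F x ω) 3)) • iMul F x η := by
      rw [← hpair (h.mem (hl x) 2), hkill, mul_zero, sub_zero]
    obtain ⟨c, hc⟩ := hspan hx (z := Hη (Pf (iMul F x ω) 3)) fun β hβ => by
      have := hpair' β
      rw [hβ, zero_smul] at this
      exact (smul_eq_zero.1 this.symm).resolve_right (hιη hx)
    obtain ⟨β, hβ⟩ := hdual hx
    refine ⟨c, fun h0 => absurd h0 hx, ?_, hc⟩
    have := hpair' β
    rwa [hβ, one_smul, hc, map_smul, hβ, smul_eq_mul, mul_one] at this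
  choose q hq0 hqη hqx using hq
  have ht (x y : Fin 7 → F) : ∃ b : F,
      Hη (Pf (iMul F x ω) 2 * iMul F y ω) = q x • y + b • x := by
    rcases eq_or_ne x 0 with rfl | hx
    · refine ⟨0, ?_⟩
      rw [hq0 0 rfl, ← zero_smul F (0 : Fin 7 → F), iMul_smul_left, h.smul 0 (hl 0),
        zero_pow two_ne_zero]
      simp
    obtain ⟨b, hb⟩ := hspan hx (z := Hη (Pf (iMul F x ω) 2 * iMul F y ω) - q x • y)
        fun β hβ => by
      have h1 := hpair (hmem x y) β x
      have h2 := hpair (h.mem (hl x) 2) β y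
      rw [hβ, zero_smul, zero_sub, hmixed, mul_neg, neg_neg] at h1
      rw [hqx, map_smul, hβ, smul_zero, zero_smul, h1, hqη, smul_smul, ← sub_smul] at h2
      rw [map_sub, map_smul, smul_eq_mul]
      linear_combination -(smul_eq_zero.1 h2).resolve_right (hιη hx)
    exact ⟨b, by rw [← hb]; abel⟩
  choose b hb using ht
  have hq_smul (c : F) (x : Fin 7 → F) : q (c • x) = c ^ 2 * q x := by
    rcases eq_or_ne x 0 with rfl | hx
    · rw [smul_zero, hq0 0 rfl, mul_zero]
    rcases eq_or_ne c 0 with rfl | hc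
    · rw [zero_smul, hq0 0 rfl]; ring
    have key := hqx (c • x)
    rw [iMul_smul_left, h.smul c (hl x), map_smul, hqx, smul_smul, smul_smul] at key
    have := smul_left_injective F hx key
    apply mul_right_cancel₀ hc
    linear_combination -this
  have hpolar := polar_smul_eq (h := fun x => Hη (Pf (iMul F x ω) 3))
    (t := fun x y => Hη (Pf (iMul F x ω) 2 * iMul F y ω)) hqx
    (fun x y => by simp only [iMul_add_left, h.three_add (hl x) (hl y), map_add]) hb hq_smul
    (fun c x => by
      simp only [iMul_smul_left, mul_smul_comm, h.two_mul_self (hl x), map_smul, smul_smul]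
      rw [mul_comm])
  have hpolar_zero (y : Fin 7 → F) : QuadraticMap.polar q 0 y = 0 := by
    rw [QuadraticMap.polar, zero_add, hq0 0 rfl, sub_zero, sub_self]
  refine ⟨QuadraticMap.ofPolar q (fun c x => by rw [hq_smul, pow_two, smul_eq_mul])
    (fun x x' y => ?_) (fun c x y => ?_), hqx, ?_⟩
  · rcases eq_or_ne y 0 with rfl | hy
    · simp only [QuadraticMap.polar_comm q _ 0, hpolar_zero, add_zero]
    simp only [QuadraticMap.polar_comm q _ y]
    refine smul_left_injective F hy ?_
    simp only [add_smul, hpolar, iMul_add_left, mul_add, map_add, smul_add]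
    abel
  · rcases eq_or_ne y 0 with rfl | hy
    · simp only [QuadraticMap.polar_comm q _ 0, hpolar_zero, smul_zero]
    simp only [QuadraticMap.polar_comm q _ y]
    refine smul_left_injective F hy ?_
    simp only [smul_assoc, hpolar, iMul_smul_left, mul_smul_comm, map_smul, smul_sub,
      smul_comm (q y) c]
  · ext x
    refine and_congr_right fun hx => ⟨fun h0 => ?_, fun h0 => ?_⟩
    · have := hqx x
      rw [h0, map_zero] at this
      exact (smul_eq_zero.1 this.symm).resolve_right hx
    · change q x = 0 at h0
      rw [hqη, h0, zero_smul]
end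

section
/- Let ω_7 = e^1 ∧ (e^{23} + e^{45} + e^{67}) be a 3-form on F_q^7 (where e^{ij} = e^i ∧ e^j). Then X_1(ω_7) = P{x ≠ 0 : Pf_2(ι_x ω_7) = 0} is the hyperplane {x_1 = 0} ≅ P^5, of cardinality (q^6−1)/(q−1). -/
open ExteriorAlgebra
open scoped LinearAlgebra.Projectivization

set_option synthInstance.maxHeartbeats 1000000

/-- The basic 1-form `e^i` (the `i`-th coordinate functional) as an element of the exterior
algebra of the dual space of `Fin n → F`. -/
noncomputable def ee (F : Type*) [Field F] {n : ℕ} (i : Fin n) :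
    ExteriorAlgebra F (Module.Dual F (Fin n → F)) :=
  ExteriorAlgebra.ι F (LinearMap.proj i)

namespace ExteriorAlgebra

variable {F : Type*} [Field F]

section Contraction

variable {V : Type*} [AddCommGroup V] [Module F V]

theorem iMul_ι (v : V) (a : Module.Dual F V) :
    iMul F v (ι F a) = algebraMap F _ (a v) :=
  CliffordAlgebra.contractLeft_ι _ _ _

theorem iMul_ι_mul (v : V) (a : Module.Dual F V) (x : ExteriorAlgebra F (Module.Dual F V)) :
    iMul F v (ι F a * x) = a v • x - ι F a * iMul F v x :=
  CliffordAlgebra.contractLeft_ι_mul _ _ _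

theorem iMul_algebraMap (v : V) (r : F) :
    iMul F v (algebraMap F (ExteriorAlgebra F (Module.Dual F V)) r) = 0 :=
  CliffordAlgebra.contractLeft_algebraMap _ _ _

theorem iMul_ι_mul_ι (v : V) (a b : Module.Dual F V) :
    iMul F v (ι F a * ι F b) = ι F (a v • b - b v • a) := by
  rw [iMul_ι_mul, iMul_ι, map_sub, map_smul, map_smul, ← Algebra.commutes, ← Algebra.smul_def]

theorem ι_mul_ι_swap (a b : Module.Dual F V) : ι F a * ι F b = -(ι F b * ι F a) :=
  eq_neg_of_add_eq_zero_left (ι_add_mul_swap a b)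

/-- A decomposable 2-form satisfies the Plücker relation. -/
theorem iMul_ι_mul_ι_mul_self (v : V) (a b : Module.Dual F V) :
    iMul F v (ι F a * ι F b) * (ι F a * ι F b) = 0 := by
  rw [iMul_ι_mul_ι, map_sub, map_smul, map_smul, sub_mul, smul_mul_assoc, smul_mul_assoc,
    ← mul_assoc (ι F a) (ι F a), ι_sq_zero, zero_mul, ι_mul_ι_swap a b, mul_neg, ← mul_assoc,
    ι_sq_zero]
  simp

theorem ι_mul_ι_mem (a b : Module.Dual F V) :
    ι F a * ι F b ∈ ⋀[F]^2 (Module.Dual F V) := by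
  rw [exteriorPower, pow_two]
  exact Submodule.mul_mem_mul ⟨a, rfl⟩ ⟨b, rfl⟩

/-- The transvection `φ ↦ φ - φ(v) a` of the dual space induces `x ↦ x - a ∧ ι_v x`. -/
theorem map_transvection (v : V) (a : Module.Dual F V) (x : ExteriorAlgebra F (Module.Dual F V)) :
    map (LinearMap.id - (Module.Dual.eval F V v).smulRight a) x = x - ι F a * iMul F v x := by
  induction x using CliffordAlgebra.left_induction with
  | algebraMap r =>
    change map _ (algebraMap F (ExteriorAlgebra F (Module.Dual F V)) r) =
      algebraMap F (ExteriorAlgebra F (Module.Dual F V)) r - ι F a * iMul F v (algebraMap F _ r)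
    rw [iMul_algebraMap, AlgHom.commutes, mul_zero, sub_zero]
  | add x y hx hy => rw [map_add, map_add, hx, hy, mul_add]; abel
  | ι_mul x m hx =>
    change map _ (ι F m * x) = ι F m * x - ι F a * iMul F v (ι F m * x)
    have h1 : ι F a * (ι F a * iMul F v x) = 0 := by rw [← mul_assoc, ι_sq_zero, zero_mul]
    have h2 : ι F a * (ι F m * iMul F v x) = -(ι F m * (ι F a * iMul F v x)) := by
      rw [← mul_assoc, ι_mul_ι_swap a m, neg_mul, mul_assoc]
    rw [map_mul, hx, map_apply_ι, iMul_ι_mul]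
    simp only [LinearMap.sub_apply, LinearMap.id_apply, LinearMap.smulRight_apply,
      Module.Dual.eval_apply, map_sub, map_smul, sub_mul, mul_sub, smul_mul_assoc,
      mul_smul_comm, h1, h2]
    simp only [smul_zero]
    abel

end Contraction

variable {n : ℕ}

/-- A form annihilated by all contractions is unchanged when coordinates are set to zero. -/
theorem map_eq_self_of_iMul_eq_zero {x : ExteriorAlgebra F (Module.Dual F (Fin n → F))}
    (hx : ∀ v, iMul F v x = 0) (S : Finset (Fin n)) :
    map (LinearMap.id - ∑ i ∈ S, (Module.Dual.eval F (Fin n → F) (Pi.single i 1)).smulRight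
      (LinearMap.proj i : Module.Dual F (Fin n → F))) x = x := by
  induction S using Finset.induction_on with
  | empty =>
    rw [Finset.sum_empty]
    exact (congrArg (fun f => map f x) (sub_zero LinearMap.id)).trans (AlgHom.congr_fun map_id x)
  | insert i S hi ih =>
    have key : (LinearMap.id - ∑ j ∈ insert i S,
        (Module.Dual.eval F (Fin n → F) (Pi.single j 1)).smulRight
          (LinearMap.proj j : Module.Dual F (Fin n → F))) =
        (LinearMap.id - (Module.Dual.eval F (Fin n → F) (Pi.single i 1)).smulRight
          (LinearMap.proj i : Module.Dual F (Fin n → F))) ∘ₗ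
        (LinearMap.id - ∑ j ∈ S, (Module.Dual.eval F (Fin n → F) (Pi.single j 1)).smulRight
          (LinearMap.proj j : Module.Dual F (Fin n → F))) := by
      have h0 : ∀ φ : Module.Dual F (Fin n → F),
          ∑ j ∈ S, φ (Pi.single j 1) * (Pi.single i 1 : Fin n → F) j = 0 := fun φ =>
        Finset.sum_eq_zero fun j hj => by
          rw [Pi.single_eq_of_ne (ne_of_mem_of_not_mem hj hi), mul_zero]
      refine LinearMap.ext fun φ => ?_
      simp only [Finset.sum_insert hi, LinearMap.comp_apply, LinearMap.sub_apply,
        LinearMap.add_apply, LinearMap.id_apply, LinearMap.sum_apply, LinearMap.smulRight_apply,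
        Module.Dual.eval_apply, LinearMap.smul_apply, LinearMap.proj_apply, smul_eq_mul, h0,
        sub_zero]
      abel
    rw [key, ← map_comp_map, AlgHom.comp_apply, ih, map_transvection, hx, mul_zero, sub_zero]

/-- A form of positive degree annihilated by all contractions vanishes. -/
theorem eq_zero_of_iMul_eq_zero {k : ℕ} (hk : k ≠ 0)
    {x : ExteriorAlgebra F (Module.Dual F (Fin n → F))}
    (hxk : x ∈ ⋀[F]^k (Module.Dual F (Fin n → F))) (hx : ∀ v, iMul F v x = 0) : x = 0 := by
  have h0 : LinearMap.id - ∑ i, (Module.Dual.eval F (Fin n → F) (Pi.single i 1)).smulRight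
      (LinearMap.proj i : Module.Dual F (Fin n → F)) = 0 := by
    ext φ j
    simp [Pi.single_apply]
  have h := map_eq_self_of_iMul_eq_zero hx Finset.univ
  rw [h0] at h
  have hmem : x ∈ (⋀[F]^k (Module.Dual F (Fin n → F))).map
      (map (0 : Module.Dual F (Fin n → F) →ₗ[F] Module.Dual F (Fin n → F))).toLinearMap :=
    ⟨x, hxk, h⟩
  rw [exteriorPower, Submodule.map_pow, ← LinearMap.range_comp, map_comp_ι, LinearMap.comp_zero,
    LinearMap.range_zero, ← Submodule.zero_eq_bot, zero_pow hk] at hmem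
  simpa using hmem

/-- The second Pfaffian of a 2-form `l` vanishes iff `ι_v l ∧ l` does for all `v`. -/
theorem pfaffian_two_eq_zero_iff
    {Pf : ExteriorAlgebra F (Module.Dual F (Fin n → F)) → ℕ →
      ExteriorAlgebra F (Module.Dual F (Fin n → F))}
    (hPf0 : ∀ l, Pf l 0 = 1)
    (hPfmem : ∀ l ∈ ⋀[F]^2 (Module.Dual F (Fin n → F)), ∀ k : ℕ, 1 ≤ k →
      Pf l k ∈ ⋀[F]^(2 * k) (Module.Dual F (Fin n → F)))
    (hPf : ∀ l ∈ ⋀[F]^2 (Module.Dual F (Fin n → F)), ∀ (k : ℕ) (v : Fin n → F),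
      iMul F v (Pf l (k + 1)) = iMul F v l * Pf l k)
    {l : ExteriorAlgebra F (Module.Dual F (Fin n → F))}
    (hl : l ∈ ⋀[F]^2 (Module.Dual F (Fin n → F))) :
    Pf l 2 = 0 ↔ ∀ v, iMul F v l * l = 0 := by
  have h1 : Pf l 1 = l := sub_eq_zero.mp <|
    eq_zero_of_iMul_eq_zero two_ne_zero (sub_mem (hPfmem l hl 1 le_rfl) hl) fun v => by
      rw [map_sub, hPf l hl 0, hPf0, mul_one, sub_self]
  have h2 : ∀ v, iMul F v (Pf l 2) = iMul F v l * l := fun v => by rw [hPf l hl 1 v, h1]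
  refine ⟨fun h v => by rw [← h2, h, map_zero], fun h => ?_⟩
  exact eq_zero_of_iMul_eq_zero (by norm_num) (hPfmem l hl 2 one_le_two) fun v => by
    rw [h2, h]

theorem iMul_omega7 (v : Fin 7 → F) :
    iMul F v (ee F 0 * (ee F 1 * ee F 2 + ee F 3 * ee F 4 + ee F 5 * ee F 6)) =
      v 0 • (ee F 1 * ee F 2 + ee F 3 * ee F 4 + ee F 5 * ee F 6) -
      ee F 0 * (v 1 • ee F 2 - v 2 • ee F 1 + (v 3 • ee F 4 - v 4 • ee F 3) +
        (v 5 • ee F 6 - v 6 • ee F 5)) := by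
  rw [ee, iMul_ι_mul]
  simp only [ee, map_add, iMul_ι_mul_ι]
  simp only [map_sub, map_smul, LinearMap.proj_apply]

theorem iMul_omega7_mem (v : Fin 7 → F) :
    iMul F v (ee F 0 * (ee F 1 * ee F 2 + ee F 3 * ee F 4 + ee F 5 * ee F 6)) ∈
      ⋀[F]^2 (Module.Dual F (Fin 7 → F)) := by
  rw [iMul_omega7]
  simp only [ee, ← map_smul, ← map_sub, ← map_add]
  exact sub_mem (Submodule.smul_mem _ _
    (add_mem (add_mem (ι_mul_ι_mem _ _) (ι_mul_ι_mem _ _)) (ι_mul_ι_mem _ _))) (ι_mul_ι_mem _ _)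

theorem iMul_omega7_mul_self_eq_zero_iff (v : Fin 7 → F) :
    (∀ w, iMul F w (iMul F v
        (ee F 0 * (ee F 1 * ee F 2 + ee F 3 * ee F 4 + ee F 5 * ee F 6))) *
      iMul F v (ee F 0 * (ee F 1 * ee F 2 + ee F 3 * ee F 4 + ee F 5 * ee F 6)) = 0) ↔
      v 0 = 0 := by
  rw [iMul_omega7]
  constructor
  · intro h
    have h4 := congrArg (iMul F (Pi.single 4 1)) (congrArg (iMul F (Pi.single 3 1))
      (congrArg (iMul F (Pi.single 2 1)) (h (Pi.single 1 1))))
    simpa [ee, iMul_ι, iMul_ι_mul, mul_add, mul_sub, sub_mul] using h4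
  · intro h w
    rw [h]
    simp only [ee, zero_smul, zero_sub, ← map_smul, ← map_sub, ← map_add]
    rw [map_neg, neg_mul_neg, iMul_ι_mul_ι_mul_self]

end ExteriorAlgebra

namespace Projectivization

/-- A coordinate hyperplane in projective `n`-space over a finite field has
`(q ^ n - 1) / (q - 1)` points. -/
theorem card_coordinate_hyperplane (F : Type*) [Field F] [Fintype F] (n : ℕ) :
    Nat.card {p : ℙ F (Fin (n + 1) → F) |
      ∃ v, ∃ hv : v ≠ 0, p = Projectivization.mk F v hv ∧ v 0 = 0} =
      (Fintype.card F ^ n - 1) / (Fintype.card F - 1) := by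
  let f : (Fin n → F) →ₗ[F] (Fin (n + 1) → F) :=
    LinearMap.pi (Fin.cons 0 fun i => LinearMap.proj i)
  have f_zero (v : Fin n → F) : f v 0 = 0 := rfl
  have f_succ (v : Fin n → F) (i : Fin n) : f v i.succ = v i := rfl
  have hf : Function.Injective f := fun v w h => funext fun i => by
    rw [← f_succ v, h, f_succ]
  have hrange : {p : ℙ F (Fin (n + 1) → F) |
      ∃ v, ∃ hv : v ≠ 0, p = Projectivization.mk F v hv ∧ v 0 = 0} =
      Set.range (Projectivization.map f hf) := by
    ext p
    constructor
    · rintro ⟨v, hv, rfl, h0⟩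
      have hfv : f (Fin.tail v) = v := by
        ext i
        refine Fin.cases ?_ (fun i => ?_) i
        · rw [f_zero, h0]
        · rw [f_succ, Fin.tail]
      have ht : Fin.tail v ≠ 0 := fun h => hv (by rw [← hfv, h, map_zero])
      refine ⟨Projectivization.mk F _ ht, ?_⟩
      simp only [Projectivization.map_mk, hfv]
    · rintro ⟨p, rfl⟩
      induction p using Projectivization.ind with
      | h v hv => exact ⟨f v, fun h => hv (hf (h.trans (map_zero f).symm)), rfl, f_zero v⟩
  rw [hrange, Nat.card_range_of_injective (Projectivization.map_injective f hf),
    Projectivization.card_of_finrank F _ (Module.finrank_fin_fun F), Nat.card_eq_fintype_card,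
    Nat.geomSum_eq Fintype.one_lt_card]

end Projectivization

/-- For `ω₇ = e¹ ∧ (e²³ + e⁴⁵ + e⁶⁷)` on `F_q^7`, the weight variety
`X₁(ω₇) = P{x ≠ 0 : Pf₂(ι_x ω₇) = 0}` is the hyperplane `{x₁ = 0} ≅ P⁵`, of cardinality
`(q⁶ − 1)/(q − 1)`. -/
theorem X1_omega7 (F : Type*) [Field F] [Fintype F] (q : ℕ) (hq : Fintype.card F = q)
    (Pf : ExteriorAlgebra F (Module.Dual F (Fin 7 → F)) → ℕ →
      ExteriorAlgebra F (Module.Dual F (Fin 7 → F)))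
    (hPf0 : ∀ l, Pf l 0 = 1)
    (hPfmem : ∀ l ∈ ⋀[F]^2 (Module.Dual F (Fin 7 → F)), ∀ k : ℕ, 1 ≤ k →
      Pf l k ∈ ⋀[F]^(2 * k) (Module.Dual F (Fin 7 → F)))
    (hPf : ∀ l ∈ ⋀[F]^2 (Module.Dual F (Fin 7 → F)), ∀ (k : ℕ) (v : Fin 7 → F),
      iMul F v (Pf l (k + 1)) = iMul F v l * Pf l k)
    (ω : ExteriorAlgebra F (Module.Dual F (Fin 7 → F)))
    (hω : ω = ee F 0 * (ee F 1 * ee F 2 + ee F 3 * ee F 4 + ee F 5 * ee F 6))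
    (X : Set (ℙ F (Fin 7 → F)))
    (hX : X = {p | ∃ v, ∃ hv : v ≠ 0, p = Projectivization.mk F v hv ∧
      Pf (iMul F v ω) 2 = 0}) :
    X = {p | ∃ v, ∃ hv : v ≠ 0, p = Projectivization.mk F v hv ∧ v 0 = 0} ∧
      Nat.card ↥X = (q ^ 6 - 1) / (q - 1) := by
  subst hq hω
  have hXeq : X = {p | ∃ v, ∃ hv : v ≠ 0, p = Projectivization.mk F v hv ∧ v 0 = 0} := by
    rw [hX]
    simp only [ExteriorAlgebra.pfaffian_two_eq_zero_iff hPf0 hPfmem hPf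
      (ExteriorAlgebra.iMul_omega7_mem _), ExteriorAlgebra.iMul_omega7_mul_self_eq_zero_iff]
  exact ⟨hXeq, by rw [hXeq]; exact Projectivization.card_coordinate_hyperplane F 6⟩
end
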